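/- arXiv:1802.03392 — 6 statements merged into one kernel-verified Lean document; each statement's English description precedes it below -/
import Mathlib

section
/- Every non-trivial tree of diameter at most four is a γβ-perfect graph. -/
open SimpleGraph

/-- `D` is a dominating set of `G`: every vertex not in `D` has a neighbor in `D`. -/
def IsDomSet {V : Type*} (G : SimpleGraph V) (D : Set V) : Prop :=
  ∀ v ∉ D, ∃ u ∈ D, G.Adj u v

/-- `C` is a vertex cover of `G`: every edge has an end-vertex in `C`. -/
def IsVtxCover {V : Type*} (G : SimpleGraph V) (C : Set V) : Prop :=
  ∀ ⦃u v : V⦄, G.Adj u v → u ∈ C ∨ v ∈ C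

/-- The domination number `γ(G)`. -/
noncomputable def domNum {V : Type*} (G : SimpleGraph V) : ℕ :=
  sInf {n | ∃ D : Set V, IsDomSet G D ∧ D.ncard = n}

/-- The covering number `β(G)`. -/
noncomputable def covNum {V : Type*} (G : SimpleGraph V) : ℕ :=
  sInf {n | ∃ C : Set V, IsVtxCover G C ∧ C.ncard = n}

/-- `G` is γβ-perfect: `G` is connected, has at least two vertices, and every
connected induced subgraph with at least two vertices satisfies `γ = β`. -/
def GammaBetaPerfect {V : Type*} [Fintype V] (G : SimpleGraph V) : Prop :=
  G.Connected ∧ 2 ≤ Fintype.card V ∧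
    ∀ S : Set V, (G.induce S).Connected → 2 ≤ S.ncard →
      domNum (G.induce S) = covNum (G.induce S)

/-- `G` contains a subgraph isomorphic to `F`, i.e. there is an injective
graph homomorphism from `F` to `G`. -/
def HasSubgraphCopy {α β : Type*} (F : SimpleGraph α) (G : SimpleGraph β) : Prop :=
  ∃ f : F →g G, Function.Injective f

section DominationCovering

variable {V : Type*} {G : SimpleGraph V}

theorem isVtxCover_univ : IsVtxCover G Set.univ := fun _ _ _ => Or.inl trivial

theorem isDomSet_univ : IsDomSet G Set.univ := fun _ hv => absurd trivial hv

theorem IsVtxCover.isDomSet (hG : ∀ v, ∃ u, G.Adj u v) {C : Set V} (hC : IsVtxCover G C) :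
    IsDomSet G C := by
  intro v hv
  obtain ⟨u, hu⟩ := hG v
  exact ⟨u, (hC hu).resolve_right hv, hu⟩

theorem exists_isVtxCover_ncard_eq_covNum : ∃ C : Set V, IsVtxCover G C ∧ C.ncard = covNum G :=
  Nat.sInf_mem (s := {n | ∃ C : Set V, IsVtxCover G C ∧ C.ncard = n}) ⟨_, _, isVtxCover_univ, rfl⟩

theorem exists_isDomSet_ncard_eq_domNum : ∃ D : Set V, IsDomSet G D ∧ D.ncard = domNum G :=
  Nat.sInf_mem (s := {n | ∃ D : Set V, IsDomSet G D ∧ D.ncard = n}) ⟨_, _, isDomSet_univ, rfl⟩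

theorem IsVtxCover.covNum_le {C : Set V} (hC : IsVtxCover G C) : covNum G ≤ C.ncard :=
  Nat.sInf_le ⟨C, hC, rfl⟩

theorem IsDomSet.domNum_le {D : Set V} (hD : IsDomSet G D) : domNum G ≤ D.ncard :=
  Nat.sInf_le ⟨D, hD, rfl⟩

theorem domNum_le_covNum (hG : ∀ v, ∃ u, G.Adj u v) : domNum G ≤ covNum G := by
  obtain ⟨C, hC, hcard⟩ := exists_isVtxCover_ncard_eq_covNum (G := G)
  exact hcard ▸ (hC.isDomSet hG).domNum_le

/-- If every vertex of `S` has a neighbor of degree one outside `S`, then a dominating set has at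
least as many vertices as `S`. -/
theorem IsDomSet.ncard_le_of_pendant [Finite V] {D S : Set V} (hD : IsDomSet G D) (b : V → V)
    (hab : ∀ a ∈ S, G.Adj a (b a)) (hb : ∀ a ∈ S, ∀ x, G.Adj x (b a) → x = a)
    (hbS : ∀ a ∈ S, b a ∉ S) : S.ncard ≤ D.ncard := by
  classical
  refine Set.ncard_le_ncard_of_injOn (fun a => if a ∈ D then a else b a) ?_ ?_ D.toFinite
  · intro a ha
    by_cases haD : a ∈ D
    · simp [haD]
    · by_cases hbD : b a ∈ D
      · simpa [haD] using hbD
      · obtain ⟨u, hu, hadj⟩ := hD _ hbD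
        exact absurd (hb a ha u hadj ▸ hu) haD
  · intro a ha a' ha' h
    by_cases haD : a ∈ D <;> by_cases haD' : a' ∈ D <;> simp only [haD, haD', if_true, if_false] at h
    · exact h
    · exact absurd (h ▸ ha) (hbS a' ha')
    · exact absurd (h ▸ ha') (hbS a ha)
    · exact hb a' ha' a (h ▸ hab a ha)

end DominationCovering

section Tree

variable {V : Type*} {G : SimpleGraph V}

theorem SimpleGraph.IsTree.eq_of_adj_of_dist_lt (hG : G.IsTree) {c v x y : V} (hx : G.Adj x v)
    (hy : G.Adj y v) (hxv : G.dist c x < G.dist c v) (hyv : G.dist c y < G.dist c v) : x = y := by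
  obtain ⟨p, -, hp⟩ := hG.connected.exists_path_of_dist c x
  obtain ⟨q, -, hq⟩ := hG.connected.exists_path_of_dist c y
  have key : ∀ {z} (r : G.Walk c z) (hz : G.Adj z v), r.length = G.dist c z →
      G.dist c z < G.dist c v → (r.concat hz).IsPath := by
    intro z r hz hr hlt
    apply Walk.isPath_of_length_eq_dist
    have := G.dist_le (r.concat hz)
    rw [Walk.length_concat] at *
    omega
  have h := (hG.isAcyclic.subsingleton_path c v).elim ⟨_, key p hx hp hxv⟩
    ⟨_, key q hy hq hyv⟩
  have h' := congrArg (fun r : G.Path c v => (r : G.Walk c v).penultimate) h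
  simpa using h'

theorem SimpleGraph.IsTree.exists_isPath_length_eq_of_dist_lt (hG : G.IsTree) {c n w w' : V}
    (hcn : G.Adj c n) (hw : G.dist w n < G.dist w c) (hw' : G.dist w' c < G.dist w' n) :
    ∃ p : G.Walk w w', p.IsPath ∧ p.length = G.dist w n + 1 + G.dist w' c := by
  obtain ⟨p, hp, hpl⟩ := hG.connected.exists_path_of_dist w n
  obtain ⟨q, hq, hql⟩ := hG.connected.exists_path_of_dist w' c
  have dist_add : ∀ {x y z : V} (r : G.Walk x y), r.length = G.dist x y → z ∈ r.support →
      G.dist x z + G.dist z y ≤ G.dist x y := by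
    classical
    intro x y z r hr hz
    rw [← hr, ← r.take_spec hz, Walk.length_append]
    exact add_le_add (G.dist_le _) (G.dist_le _)
  refine ⟨p.append (.cons hcn.symm q.reverse), ?_, ?_⟩
  · rw [Walk.isPath_def, Walk.support_append, Walk.support_cons, List.tail_cons]
    rw [Walk.support_reverse, List.nodup_append']
    refine ⟨hp.support_nodup, List.nodup_reverse.2 hq.support_nodup, ?_⟩
    intro z hzp hzq
    have h1 := dist_add p hpl hzp
    have h2 := dist_add q hql (List.mem_reverse.1 hzq)
    have h3 := hG.connected.dist_triangle (u := w) (v := z) (w := c)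
    have h4 := hG.connected.dist_triangle (u := w') (v := z) (w := n)
    omega
  · simp [hpl, hql]
    omega

theorem SimpleGraph.IsTree.exists_forall_dist_le_two [Finite V] (hG : G.IsTree)
    (h4 : ∀ {u v : V} (p : G.Walk u v), p.IsPath → p.length ≤ 4) :
    ∃ c, ∀ v, G.dist c v ≤ 2 := by
  have := hG.connected.nonempty
  choose f hf using fun u => Finite.exists_max (G.dist u)
  obtain ⟨c, hc⟩ := Finite.exists_min fun u => G.dist u (f u)
  refine ⟨c, fun v => (hf c v).trans ?_⟩
  by_contra! hlt
  obtain ⟨p, hp⟩ := hG.connected.exists_walk_length_eq_dist c (f c)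
  have hnil : ¬ p.Nil := fun h => by
    rw [← Walk.length_eq_zero_iff] at h
    omega
  obtain ⟨n, hcn, q, rfl⟩ := Walk.not_nil_iff.1 hnil
  have hq := G.dist_le q
  rw [Walk.length_cons] at hp
  have h1 : G.dist c (f c) ≤ G.dist n (f n) := hc n
  have h2 := hf c (f n)
  have h3 := hG.dist_eq_dist_add_one_of_adj (f n) hcn
  rw [G.dist_comm (u := f n), G.dist_comm (u := f n)] at h3
  have h5 := hG.connected.dist_triangle (u := c) (v := n) (w := f c)
  have h6 := SimpleGraph.dist_eq_one_iff_adj.2 hcn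
  obtain ⟨r, hr, hrl⟩ := hG.exists_isPath_length_eq_of_dist_lt (w := f c) (w' := f n) hcn
    (by rw [G.dist_comm (u := f c), G.dist_comm (u := f c)]; omega)
    (by rw [G.dist_comm (u := f n), G.dist_comm (u := f n)]; omega)
  rw [G.dist_comm (u := f c), G.dist_comm (u := f n)] at hrl
  have := h4 r hr
  omega

theorem SimpleGraph.IsTree.covNum_le_domNum_of_dist_le_two [Finite V] [Nontrivial V]
    (hG : G.IsTree) {c : V} (hc : ∀ v, G.dist c v ≤ 2) : covNum G ≤ domNum G := by
  have dist_zero : ∀ {v}, G.dist c v = 0 → c = v := fun h => hG.connected.dist_eq_zero_iff.1 h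
  have pendant : ∀ {u v}, G.Adj u v → G.dist c v = G.dist c u + 1 → G.dist c u = 1 →
      ∀ x, G.Adj x v → x = u := by
    intro u v huv h1 h2 x hx
    have h3 := hG.dist_eq_dist_add_one_of_adj c hx
    have h4 := hc x
    exact hG.eq_of_adj_of_dist_lt (c := c) hx huv (by omega) (by omega)
  let S : Set V := {a | ∃ b, b ≠ c ∧ G.Adj a b ∧ ∀ x, G.Adj x b → x = a}
  have cover_aux : ∀ {u v}, G.Adj u v → G.dist c v = G.dist c u + 1 → u ∈ S ∨ v ∈ S := by
    intro u v huv h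
    have hvc : v ≠ c := by
      rintro rfl
      simp at h
    have h2 := hc v
    by_cases hu : G.dist c u = 0
    · by_cases hv : ∀ x, G.Adj x v → x = u
      · exact Or.inl ⟨v, hvc, huv, hv⟩
      · push Not at hv
        obtain ⟨w, hwv, hwu⟩ := hv
        have h3 := hG.dist_eq_dist_add_one_of_adj c hwv
        have hwc : w ≠ c := fun e => hwu (e.trans (dist_zero hu))
        have h4 : G.dist c w ≠ 0 := fun e => hwc (dist_zero e).symm
        exact Or.inr ⟨w, hwc, hwv.symm, pendant hwv.symm (by omega) (by omega)⟩
    · exact Or.inl ⟨v, hvc, huv, pendant huv h (by omega)⟩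
  have cover : IsVtxCover G S := by
    intro u v huv
    rcases hG.dist_eq_dist_add_one_of_adj c huv with h | h
    · exact (cover_aux huv.symm h).symm
    · exact cover_aux huv h
  have no_pair : ∀ {a a'}, a ≠ c → a' ≠ c → G.Adj a a' → (∀ x, G.Adj x a' → x = a) →
      (∀ x, G.Adj x a → x = a') → G.dist c a' ≠ G.dist c a + 1 := by
    intro a a' ha ha' hadj h1 h2 hd
    have h3 : G.dist c a ≠ 0 := fun e => ha (dist_zero e).symm
    have h4 := hc a'
    have h5 : G.dist c a = 1 := by omega
    exact ha' (h2 c (SimpleGraph.dist_eq_one_iff_adj.1 h5)).symm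
  obtain ⟨D, hD, hcard⟩ := exists_isDomSet_ncard_eq_domNum (G := G)
  rw [← hcard]
  refine cover.covNum_le.trans ?_
  choose! b hbc hab hb using fun (a : V) (ha : a ∈ S) => ha
  refine hD.ncard_le_of_pendant b hab hb ?_
  intro a ha hba
  have e : b (b a) = a := hb a ha _ (hab _ hba).symm
  have hac := e ▸ hbc _ hba
  have hb' := e ▸ hb _ hba
  rcases hG.dist_eq_dist_add_one_of_adj c (hab a ha) with h | h
  · exact no_pair (hbc a ha) hac (hab a ha).symm hb' (hb a ha) h
  · exact no_pair hac (hbc a ha) (hab a ha) (hb a ha) hb' h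

theorem SimpleGraph.IsTree.domNum_eq_covNum [Finite V] [Nontrivial V] (hG : G.IsTree)
    (h4 : ∀ {u v : V} (p : G.Walk u v), p.IsPath → p.length ≤ 4) : domNum G = covNum G := by
  obtain ⟨c, hc⟩ := hG.exists_forall_dist_le_two h4
  refine (domNum_le_covNum fun v => ?_).antisymm (hG.covNum_le_domNum_of_dist_le_two hc)
  simpa only [G.adj_comm] using hG.connected.preconnected.exists_adj_of_nontrivial v

end Tree

/-- Every non-trivial tree of diameter at most four is a γβ-perfect graph. -/
theorem tree_diam_le_four_gammaBetaPerfect {V : Type*} [Fintype V] (G : SimpleGraph V)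
    (htree : G.IsTree) (hnontrivial : 2 ≤ Fintype.card V) (hdiam : G.diam ≤ 4) :
    GammaBetaPerfect G := by
  refine ⟨htree.connected, hnontrivial, fun S hS hcard => ?_⟩
  have : Nontrivial S := Set.nontrivial_coe_sort.2 ((Set.one_lt_ncard_iff_nontrivial).1 hcard)
  have := htree.connected.nonempty
  have path_le : ∀ {u v : V} (p : G.Walk u v), p.IsPath → p.length ≤ 4 := by
    intro u v p hp
    obtain ⟨q, hq, hql⟩ := htree.connected.exists_path_of_dist u v
    have h : p = q := congrArg Subtype.val
      ((htree.isAcyclic.subsingleton_path u v).elim ⟨p, hp⟩ ⟨q, hq⟩)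
    rw [h, hql]
    exact (dist_le_diam (connected_iff_ediam_ne_top.1 htree.connected)).trans hdiam
  refine IsTree.domNum_eq_covNum ⟨hS, htree.isAcyclic.induce S⟩ fun p hp => ?_
  have := path_le _ (hp.map (f := (Embedding.induce (G := G) S).toHom) Subtype.val_injective)
  rwa [Walk.length_map] at this
end

section
/- If a non-trivial connected finite simple graph G is γβ-perfect, then G is not isomorphic to the cycle C_5, and G contains neither the triangle C_3 nor the path P_6 as a (not necessarily induced) subgraph. -/
open SimpleGraph

/-- A surjective homomorphism cannot increase the domination number. -/
theorem domNum_le_of_surjective {α β : Type*} [Finite α] {F : SimpleGraph α} {H : SimpleGraph β}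
    (f : F →g H) (hf : Function.Surjective f) : domNum H ≤ domNum F := by
  obtain ⟨D, hD, hcard⟩ := Nat.sInf_mem
    (s := {n | ∃ D : Set α, IsDomSet F D ∧ D.ncard = n}) ⟨_, Set.univ, by simp [IsDomSet], rfl⟩
  calc
    domNum H ≤ (f '' D).ncard := by
      refine Nat.sInf_le ⟨f '' D, fun v hv => ?_, rfl⟩
      obtain ⟨a, rfl⟩ := hf v
      obtain ⟨u, hu, huv⟩ := hD a fun ha => hv ⟨a, ha, rfl⟩
      exact ⟨f u, ⟨u, hu, rfl⟩, f.map_adj huv⟩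
    _ ≤ D.ncard := Set.ncard_image_le D.toFinite
    _ = domNum F := hcard

/-- An injective homomorphism cannot decrease the covering number. -/
theorem covNum_le_of_injective {α β : Type*} [Finite β] {F : SimpleGraph α} {H : SimpleGraph β}
    (f : F →g H) (hf : Function.Injective f) : covNum F ≤ covNum H := by
  obtain ⟨C, hC, hcard⟩ := Nat.sInf_mem
    (s := {n | ∃ C : Set β, IsVtxCover H C ∧ C.ncard = n}) ⟨_, Set.univ, by simp [IsVtxCover], rfl⟩
  calc
    covNum F ≤ (f ⁻¹' C).ncard :=
      Nat.sInf_le ⟨f ⁻¹' C, fun u v huv => hC (f.map_adj huv), rfl⟩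
    _ ≤ C.ncard := Set.ncard_le_ncard_of_injOn f (fun _ h => h) hf.injOn C.toFinite
    _ = covNum H := hcard

/-- A γβ-perfect graph has no subgraph copy of a non-trivial connected graph `F` with
`γ(F) < β(F)`. -/
theorem GammaBetaPerfect.not_hasSubgraphCopy {α V : Type*} [Fintype α] [Fintype V]
    {F : SimpleGraph α} {G : SimpleGraph V} (hG : GammaBetaPerfect G) (hF : F.Connected)
    (hcard : 2 ≤ Fintype.card α) (hlt : domNum F < covNum F) : ¬ HasSubgraphCopy F G := by
  rintro ⟨f, hf⟩
  let g : F →g G.induce (Set.range f) := ⟨Set.rangeFactorization f, fun h => f.map_adj h⟩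
  have hsurj : Function.Surjective g := Set.rangeFactorization_surjective
  have hinj : Function.Injective g := fun a b h => hf (congrArg Subtype.val h)
  have hS : 2 ≤ (Set.range f).ncard := by
    rwa [← Nat.card_coe_set_eq, Nat.card_range_of_injective hf, Nat.card_eq_fintype_card]
  have heq := hG.2.2 (Set.range f) (hF.map g hsurj) hS
  have hdom := domNum_le_of_surjective g hsurj
  have hcov := covNum_le_of_injective g hinj
  omega

/-- Bounds a dominating set and all vertex covers of a finite graph in terms of finsets. -/
theorem domNum_lt_covNum {α : Type*} {F : SimpleGraph α} [Fintype α] (D : Finset α)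
    (hD : ∀ v ∉ D, ∃ u ∈ D, F.Adj u v)
    (hC : ∀ C : Finset α, (∀ u v, F.Adj u v → u ∈ C ∨ v ∈ C) → D.card < C.card) :
    domNum F < covNum F := by
  obtain ⟨C, hcov, hcard⟩ := Nat.sInf_mem
    (s := {n | ∃ C : Set α, IsVtxCover F C ∧ C.ncard = n}) ⟨_, Set.univ, by simp [IsVtxCover], rfl⟩
  classical
  calc
    domNum F ≤ D.card := Nat.sInf_le ⟨D, by simpa [IsDomSet] using hD, Set.ncard_coe_finset D⟩
    _ < C.toFinset.card := hC _ fun u v h => by simpa using hcov h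
    _ = covNum F := by rw [← Set.ncard_eq_toFinset_card', hcard, covNum]

theorem domNum_lt_covNum_cycleGraph_three : domNum (cycleGraph 3) < covNum (cycleGraph 3) :=
  domNum_lt_covNum {0} (by decide) (by decide)

theorem domNum_lt_covNum_cycleGraph_five : domNum (cycleGraph 5) < covNum (cycleGraph 5) :=
  domNum_lt_covNum {0, 2} (by decide) (by decide +kernel)

theorem domNum_lt_covNum_pathGraph_six : domNum (pathGraph 6) < covNum (pathGraph 6) :=
  domNum_lt_covNum {1, 4} (by simp only [pathGraph_adj]; decide)
    (by simp only [pathGraph_adj]; decide +kernel)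

/-- If a non-trivial connected graph `G` is γβ-perfect, then `G` is not isomorphic to `C₅`,
and `G` contains neither `C₃` nor `P₆` as a subgraph. -/
theorem gammaBetaPerfect_forbidden {V : Type*} [Fintype V] (G : SimpleGraph V)
    (hconn : G.Connected) (hnontrivial : 2 ≤ Fintype.card V)
    (hperf : GammaBetaPerfect G) :
    ¬ Nonempty (G ≃g cycleGraph 5) ∧
      ¬ HasSubgraphCopy (cycleGraph 3) G ∧ ¬ HasSubgraphCopy (pathGraph 6) G := by
  refine ⟨?_, ?_, ?_⟩
  · rintro ⟨e⟩
    exact hperf.not_hasSubgraphCopy cycleGraph_connected (by simp)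
      domNum_lt_covNum_cycleGraph_five ⟨e.symm.toHom, e.symm.injective⟩
  · exact hperf.not_hasSubgraphCopy cycleGraph_connected (by simp)
      domNum_lt_covNum_cycleGraph_three
  · exact hperf.not_hasSubgraphCopy (pathGraph_connected 5) (by simp)
      domNum_lt_covNum_pathGraph_six
end

section
/- If G is a γβ-perfect graph, then the path P_6 on six vertices is not a subgraph (not merely not an induced subgraph) of G. -/
open SimpleGraph

theorem domNum_le_two_of_pathGraph_six {V : Type*} {H : SimpleGraph V} (g : pathGraph 6 →g H)
    (hg : Function.Bijective g) : domNum H ≤ 2 := by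
  refine Nat.sInf_le ⟨{g 1, g 4}, fun v hv ↦ ?_, Set.ncard_pair (hg.1.ne (by decide))⟩
  obtain ⟨i, rfl⟩ := hg.2 v
  have adj {a b : Fin 6} (h : a.val + 1 = b.val ∨ b.val + 1 = a.val) : H.Adj (g a) (g b) :=
    g.map_adj (pathGraph_adj.2 h)
  fin_cases i
  · exact ⟨g 1, by simp, adj (by decide)⟩
  · exact absurd (by simp) hv
  · exact ⟨g 1, by simp, adj (by decide)⟩
  · exact ⟨g 4, by simp, adj (by decide)⟩
  · exact absurd (by simp) hv
  · exact ⟨g 4, by simp, adj (by decide)⟩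

theorem three_le_covNum_of_pathGraph_six {V : Type*} [Finite V] {H : SimpleGraph V}
    (g : pathGraph 6 →g H) (hg : Function.Injective g) : 3 ≤ covNum H := by
  refine le_csInf ⟨_, Set.univ, fun _ _ _ ↦ Or.inl trivial, rfl⟩ ?_
  rintro _ ⟨C, hC, rfl⟩
  have pick (a b : Fin 6) (h : a.val + 1 = b.val) : ∃ i, (i = a ∨ i = b) ∧ g i ∈ C := by
    rcases hC (g.map_adj (pathGraph_adj.2 (Or.inl h))) with h | h
    · exact ⟨a, Or.inl rfl, h⟩
    · exact ⟨b, Or.inr rfl, h⟩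
  obtain ⟨i, hi, hiC⟩ := pick 0 1 (by decide)
  obtain ⟨j, hj, hjC⟩ := pick 2 3 (by decide)
  obtain ⟨k, hk, hkC⟩ := pick 4 5 (by decide)
  have hij : i ≠ j := by rcases hi with rfl | rfl <;> rcases hj with rfl | rfl <;> decide
  have hik : i ≠ k := by rcases hi with rfl | rfl <;> rcases hk with rfl | rfl <;> decide
  have hjk : j ≠ k := by rcases hj with rfl | rfl <;> rcases hk with rfl | rfl <;> decide
  exact (Set.two_lt_ncard_iff (Set.toFinite C)).2
    ⟨g i, g j, g k, hiC, hjC, hkC, hg.ne hij, hg.ne hik, hg.ne hjk⟩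

/-- If `G` is γβ-perfect, then `P₆` is not a subgraph of `G`. -/
theorem gammaBetaPerfect_no_P6 {V : Type*} [Fintype V] (G : SimpleGraph V)
    (hperf : GammaBetaPerfect G) :
    ¬ HasSubgraphCopy (pathGraph 6) G := by
  rintro ⟨f, hf⟩
  let g : pathGraph 6 →g G.induce (Set.range f) :=
    ⟨Set.rangeFactorization f, fun h ↦ f.map_adj h⟩
  have hg : Function.Bijective g :=
    ⟨fun _ _ h ↦ hf (congrArg Subtype.val h), Set.rangeFactorization_surjective⟩
  have hconn : (G.induce (Set.range f)).Connected :=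
    (pathGraph_connected 5).map g hg.2
  have hcard : 2 ≤ (Set.range f).ncard := by
    simp [← Nat.card_coe_set_eq, Nat.card_range_of_injective hf]
  have heq := hperf.2.2 _ hconn hcard
  have hdom := domNum_le_two_of_pathGraph_six g hg
  have hcov := three_le_covNum_of_pathGraph_six g hg.1
  omega
end

section
/- Let G be a non-trivial connected finite simple graph such that G is not isomorphic to C_5 and G contains neither C_3 nor P_6 as a subgraph. Then G is a tree of diameter at most four, or G is isomorphic to a connected subgraph of the complete bipartite graph K_{2,n} for some n. -/
open SimpleGraph

section

variable {V : Type*} {G : SimpleGraph V}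

theorem hasSubgraphCopy_cycleGraph_three {a b c : V} (hab : G.Adj a b) (hbc : G.Adj b c)
    (hca : G.Adj c a) : HasSubgraphCopy (cycleGraph 3) G := by
  refine ⟨⟨![a, b, c], ?_⟩, ?_⟩
  · intro i j hij
    have := hab.symm
    have := hbc.symm
    have := hca.symm
    fin_cases i <;> fin_cases j <;> simp_all
  · intro i j hij
    have := hab.ne
    have := hbc.ne
    have := hca.ne
    fin_cases i <;> fin_cases j <;> simp_all

theorem hasSubgraphCopy_pathGraph {n : ℕ} (p : ℕ → V)
    (hadj : ∀ i, i + 1 < n → G.Adj (p i) (p (i + 1)))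
    (hinj : ∀ i < n, ∀ j < n, p i = p j → i = j) : HasSubgraphCopy (pathGraph n) G := by
  refine ⟨⟨fun i => p i, ?_⟩, fun i j hij => Fin.ext (hinj i i.2 j j.2 hij)⟩
  intro i j hij
  rw [pathGraph_adj] at hij
  rcases hij with h | h
  · simpa [h] using hadj i (by omega)
  · simpa [h] using (hadj j (by omega)).symm

theorem hasSubgraphCopy_pathGraph_six {a b c d e f : V} (hab : G.Adj a b) (hbc : G.Adj b c)
    (hcd : G.Adj c d) (hde : G.Adj d e) (hef : G.Adj e f) (hnodup : [a, b, c, d, e, f].Nodup) :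
    HasSubgraphCopy (pathGraph 6) G := by
  refine hasSubgraphCopy_pathGraph (fun i => [a, b, c, d, e, f].getD i a) ?_ ?_
  · intro i hi
    have : i < 5 := by omega
    interval_cases i <;> simpa
  · intro i hi j hj hij
    rw [List.getD_eq_getElem _ _ (by simpa using hi),
      List.getD_eq_getElem _ _ (by simpa using hj)] at hij
    exact hnodup.getElem_inj_iff.mp hij

theorem SimpleGraph.Connected.forall_of_adj (hconn : G.Connected) {P : V → Prop} {a : V} (ha : P a)
    (hP : ∀ u v, P u → G.Adj u v → P v) (v : V) : P v := by
  obtain ⟨w⟩ := hconn.preconnected a v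
  induction w with
  | nil => exact ha
  | cons h _ ih => exact ih (hP _ _ ha h)

/-- The diameter of a connected graph is less than the length of any path it does not contain. -/
theorem diam_lt_of_not_hasSubgraphCopy_pathGraph [Finite V] (hconn : G.Connected) {n : ℕ}
    (hP : ¬ HasSubgraphCopy (pathGraph (n + 1)) G) : G.diam < n := by
  by_contra! hn
  have := hconn.nonempty
  obtain ⟨u, v, huv⟩ := G.exists_dist_eq_diam
  obtain ⟨p, hp, hlen⟩ := hconn.exists_path_of_dist u v
  refine hP (hasSubgraphCopy_pathGraph p.getVert (fun i hi => p.adj_getVert_succ (by omega)) ?_)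
  intro i hi j hj hij
  exact hp.getVert_injOn (by simp; omega) (by simp; omega) hij

theorem SimpleGraph.Walk.IsCycle.hasSubgraphCopy_pathGraph {v : V} {w : G.Walk v v}
    (hw : w.IsCycle) {n : ℕ} (hn : n ≤ w.length) : HasSubgraphCopy (pathGraph n) G := by
  refine _root_.hasSubgraphCopy_pathGraph w.getVert (fun i hi => w.adj_getVert_succ (by omega)) ?_
  intro i hi j hj hij
  exact hw.getVert_injOn' (by simp; omega) (by simp; omega) hij

theorem nonempty_iso_cycleGraph_five {a b c d e : V} (hconn : G.Connected)
    (hC3 : ¬ HasSubgraphCopy (cycleGraph 3) G) (hP6 : ¬ HasSubgraphCopy (pathGraph 6) G)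
    (hab : G.Adj a b) (hbc : G.Adj b c) (hcd : G.Adj c d) (hde : G.Adj d e) (hea : G.Adj e a)
    (hnodup : [a, b, c, d, e].Nodup) : Nonempty (G ≃g cycleGraph 5) := by
  have hout {p q r s t x : V} (hpq : G.Adj p q) (hqr : G.Adj q r) (hrs : G.Adj r s)
      (hst : G.Adj s t) (hn : [p, q, r, s, t].Nodup) (hpx : G.Adj p x) :
      x ∈ [p, q, r, s, t] := by
    by_contra hx
    exact hP6 (hasSubgraphCopy_pathGraph_six hpx.symm hpq hqr hrs hst
      (List.nodup_cons.mpr ⟨hx, hn⟩))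
  have hall : ∀ x, x ∈ [a, b, c, d, e] := by
    refine hconn.forall_of_adj (a := a) (by simp) fun u v hu huv => ?_
    simp only [List.mem_cons, List.not_mem_nil, or_false] at hu
    rcases hu with rfl | rfl | rfl | rfl | rfl
    · exact hout hab hbc hcd hde hnodup huv
    · have := hout hbc hcd hde hea (by grind) huv
      grind
    · have := hout hcd hde hea hab (by grind) huv
      grind
    · have := hout hde hea hab hbc (by grind) huv
      grind
    · have := hout hea hab hbc hcd (by grind) huv
      grind
  have hchord {p q r : V} (hpq : G.Adj p q) (hqr : G.Adj q r) : ¬ G.Adj p r := fun h =>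
    hC3 (hasSubgraphCopy_cycleGraph_three hpq hqr h.symm)
  have hac := hchord hab hbc
  have hbd := hchord hbc hcd
  have hce := hchord hcd hde
  have hda := hchord hde hea
  have heb := hchord hea hab
  have hbij : Function.Bijective ![a, b, c, d, e] := by
    constructor
    · rwa [← List.nodup_ofFn]
    · intro x
      have hx := hall x
      simp only [List.mem_cons, List.not_mem_nil, or_false] at hx
      rcases hx with rfl | rfl | rfl | rfl | rfl
      exacts [⟨0, rfl⟩, ⟨1, rfl⟩, ⟨2, rfl⟩, ⟨3, rfl⟩, ⟨4, rfl⟩]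
  refine ⟨RelIso.symm ⟨Equiv.ofBijective _ hbij, ?_⟩⟩
  intro i j
  have hsymm {p q : V} (h : ¬ G.Adj p q) : ¬ G.Adj q p := fun h' => h h'.symm
  fin_cases i <;> fin_cases j <;>
    simp [cycleGraph_adj, hab, hab.symm, hbc, hbc.symm, hcd, hcd.symm, hde, hde.symm, hea, hea.symm,
      hac, hsymm hac, hbd, hsymm hbd, hce, hsymm hce, hda, hsymm hda, heb, hsymm heb] <;>
    decide

theorem exists_hom_completeBipartiteGraph_two [Finite V] {a c : V}
    (hnadj : ¬ G.Adj a c) (hcover : ∀ u v, G.Adj u v → u = a ∨ u = c ∨ v = a ∨ v = c) :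
    ∃ n : ℕ, ∃ f : G →g completeBipartiteGraph (Fin 2) (Fin n), Function.Injective f := by
  classical
  obtain ⟨n, ⟨e⟩⟩ := Finite.exists_equiv_fin V
  refine ⟨n, ⟨fun v => if v = a then .inl 0 else if v = c then .inl 1 else .inr (e v), ?_⟩, ?_⟩
  · intro u v huv
    have := hcover u v huv
    have := huv.symm
    have := huv.ne
    split_ifs <;> simp_all
  · intro u v huv
    change (if u = a then _ else _) = (if v = a then _ else _) at huv
    split_ifs at huv <;> simp_all

theorem exists_hom_completeBipartiteGraph_two_of_four_cycle [Finite V] {a b c d : V}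
    (hconn : G.Connected)
    (hC3 : ¬ HasSubgraphCopy (cycleGraph 3) G) (hP6 : ¬ HasSubgraphCopy (pathGraph 6) G)
    (hab : G.Adj a b) (hbc : G.Adj b c) (hcd : G.Adj c d) (hda : G.Adj d a)
    (hac : a ≠ c) (hbd : b ≠ d)
    (hb : ∀ x, G.Adj b x → x = a ∨ x = c) (hd : ∀ x, G.Adj d x → x = a ∨ x = c) :
    ∃ n : ℕ, ∃ f : G →g completeBipartiteGraph (Fin 2) (Fin n), Function.Injective f := by
  have hedge (u v : V) (hu : u = a ∨ u = c ∨ G.Adj a u ∨ G.Adj c u) (huv : G.Adj u v) :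
      u = a ∨ u = c ∨ v = a ∨ v = c := by
    by_contra! h
    have hub : u ≠ b := by rintro rfl; grind
    have hud : u ≠ d := by rintro rfl; grind
    have hvb : v ≠ b := by rintro rfl; grind [huv.symm]
    have hvd : v ≠ d := by rintro rfl; grind [huv.symm]
    rcases hu with hu | hu | hu | hu
    · exact h.1 hu
    · exact h.2.1 hu
    · refine hP6 (hasSubgraphCopy_pathGraph_six huv.symm hu.symm hab hbc hcd ?_)
      grind [huv.ne, hab.ne, hbc.ne, hcd.ne, hda.ne]
    · refine hP6 (hasSubgraphCopy_pathGraph_six huv.symm hu.symm hcd hda hab ?_)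
      grind [huv.ne, hab.ne, hbc.ne, hcd.ne, hda.ne]
  have hall := hconn.forall_of_adj (P := fun u => u = a ∨ u = c ∨ G.Adj a u ∨ G.Adj c u)
    (a := a) (.inl rfl) fun u v hu huv => by
      rcases hedge u v hu huv with rfl | rfl | rfl | rfl <;> simp [huv]
  exact exists_hom_completeBipartiteGraph_two
    (fun h => hC3 (hasSubgraphCopy_cycleGraph_three hab hbc h.symm))
    fun u v huv => hedge u v (hall u) huv

/-- Two consecutive vertices of a four-cycle cannot both have neighbors off the cycle
in a graph without `C₃` and `P₆`. -/
theorem hasSubgraphCopy_of_four_cycle {a b c d x y : V}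
    (hab : G.Adj a b) (hbc : G.Adj b c) (hcd : G.Adj c d) (hda : G.Adj d a)
    (hac : a ≠ c) (hbd : b ≠ d) (hax : G.Adj a x) (hby : G.Adj b y)
    (hxb : x ≠ b) (hxd : x ≠ d) (hya : y ≠ a) (hyc : y ≠ c) :
    HasSubgraphCopy (cycleGraph 3) G ∨ HasSubgraphCopy (pathGraph 6) G := by
  by_cases hxy : x = y
  · subst hxy
    exact .inl (hasSubgraphCopy_cycleGraph_three hab hby hax.symm)
  by_cases hxc : x = c
  · subst hxc
    exact .inl (hasSubgraphCopy_cycleGraph_three hab hbc hax.symm)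
  by_cases hyd : y = d
  · subst hyd
    exact .inl (hasSubgraphCopy_cycleGraph_three hab hby hda)
  refine .inr (hasSubgraphCopy_pathGraph_six hax.symm hda.symm hcd.symm hbc.symm hby ?_)
  grind [hab.ne, hbc.ne, hcd.ne, hda.ne, hax.ne, hby.ne]

end

/-- If a non-trivial connected graph `G` is not isomorphic to `C₅` and contains neither `C₃`
nor `P₆` as a subgraph, then `G` is a tree of diameter at most four or `G` is isomorphic to
a connected subgraph of `K_{2,n}` for some `n`. -/
theorem forbidden_implies_structure {V : Type*} [Fintype V] (G : SimpleGraph V)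
    (hconn : G.Connected) (hnontrivial : 2 ≤ Fintype.card V)
    (hC5 : ¬ Nonempty (G ≃g cycleGraph 5))
    (hC3 : ¬ HasSubgraphCopy (cycleGraph 3) G)
    (hP6 : ¬ HasSubgraphCopy (pathGraph 6) G) :
    (G.IsTree ∧ G.diam ≤ 4) ∨
      ∃ n : ℕ, ∃ f : G →g completeBipartiteGraph (Fin 2) (Fin n), Function.Injective f := by
  by_cases hacyc : G.IsAcyclic
  · exact .inl ⟨⟨hconn, hacyc⟩,
      Nat.le_of_lt_succ (diam_lt_of_not_hasSubgraphCopy_pathGraph hconn hP6)⟩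
  right
  simp only [IsAcyclic, not_forall, not_not] at hacyc
  obtain ⟨v, w, hw⟩ := hacyc
  have hlt : w.length < 6 := by
    by_contra! h
    exact hP6 (hw.hasSubgraphCopy_pathGraph h)
  have hadj (i : ℕ) (hi : i < w.length) := w.adj_getVert_succ hi
  have hinj {i j : ℕ} (hi : i < w.length) (hj : j < w.length) (hij : i ≠ j) :
      w.getVert i ≠ w.getVert j := fun h =>
    hij (hw.getVert_injOn' (by simp; omega) (by simp; omega) h)
  have hlast : w.getVert w.length = w.getVert 0 := by simp
  obtain h | h | h : w.length = 3 ∨ w.length = 4 ∨ w.length = 5 := by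
    have := hw.three_le_length
    omega
  · rw [h] at hadj hlast
    exact absurd (hasSubgraphCopy_cycleGraph_three (hadj 0 (by simp)) (hadj 1 (by simp))
      (hlast ▸ hadj 2 (by simp))) hC3
  · rw [h] at hadj hlast hinj
    have hab := hadj 0 (by simp)
    have hbc := hadj 1 (by simp)
    have hcd := hadj 2 (by simp)
    have hda := hlast ▸ hadj 3 (by simp)
    have hac := hinj (i := 0) (j := 2) (by simp) (by simp) (by simp)
    have hbd := hinj (i := 1) (j := 3) (by simp) (by simp) (by simp)
    simp only [Nat.reduceAdd] at hab hbc hcd hda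
    generalize w.getVert 0 = a at *
    generalize w.getVert 1 = b at *
    generalize w.getVert 2 = c at *
    generalize w.getVert 3 = d at *
    by_cases hout : (∀ x, G.Adj b x → x = a ∨ x = c) ∧ (∀ x, G.Adj d x → x = a ∨ x = c)
    · exact exists_hom_completeBipartiteGraph_two_of_four_cycle hconn hC3 hP6 hab hbc hcd hda
        hac hbd hout.1 hout.2
    · have hno {p q r s x y : V} (hpq : G.Adj p q) (hqr : G.Adj q r) (hrs : G.Adj r s)
          (hsp : G.Adj s p) (hpr : p ≠ r) (hqs : q ≠ s) (hpx : G.Adj p x) (hqy : G.Adj q y)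
          (hy : ¬ (y = p ∨ y = r)) : x = q ∨ x = s := by
        by_contra hx
        rw [not_or] at hx hy
        exact (hasSubgraphCopy_of_four_cycle hpq hqr hrs hsp hpr hqs hpx hqy
          hx.1 hx.2 hy.1 hy.2).elim hC3 hP6
      refine exists_hom_completeBipartiteGraph_two_of_four_cycle hconn hC3 hP6 hbc hcd hda hab
        hbd hac.symm ?_ ?_
      all_goals
        intro x hx
        simp only [not_and_or, not_forall] at hout
        obtain ⟨y, hy, hyn⟩ | ⟨y, hy, hyn⟩ := hout
      · exact hno hbc.symm hab.symm hda.symm hcd.symm hac.symm hbd hx hy (by tauto)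
      · exact (hno hcd hda hab hbc hac.symm hbd.symm hx hy (by tauto)).symm
      · exact hno hab hbc hcd hda hac hbd hx hy hyn
      · exact (hno hda.symm hcd.symm hbc.symm hab.symm hac hbd.symm hx hy hyn).symm
  · rw [h] at hadj hlast hinj
    refine absurd (nonempty_iso_cycleGraph_five hconn hC3 hP6 (hadj 0 (by simp)) (hadj 1 (by simp))
      (hadj 2 (by simp)) (hadj 3 (by simp)) (hlast ▸ hadj 4 (by simp)) ?_) hC5
    simp [-Walk.getVert_zero, hinj]
end

section
/- Let G be a connected finite simple graph that is not isomorphic to C_5 and contains neither C_3 nor P_6 as a subgraph. Then every cycle of G is a chordless (induced) cycle of length four. -/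
open SimpleGraph

theorem SimpleGraph.not_adj_of_common_neighbor {V : Type*} {G : SimpleGraph V}
    (hC3 : ¬ HasSubgraphCopy (cycleGraph 3) G) {x y z : V}
    (hxy : G.Adj x y) (hyz : G.Adj y z) : ¬ G.Adj z x := by
  intro hzx
  refine hC3 ⟨⟨![x, y, z], ?_⟩, ?_⟩
  · intro a b hab
    have hne := hab.ne
    fin_cases a <;> fin_cases b <;> simp_all [G.adj_comm]
  · change Function.Injective ![x, y, z]
    have h1 := hxy.ne
    have h2 := hyz.ne
    have h3 := hzx.ne
    intro a b hab
    fin_cases a <;> fin_cases b <;> simp_all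

/-- In a triangle-free graph, every copy of a graph of diameter at most two is induced. -/
theorem SimpleGraph.chordless_of_common_neighbor {V W : Type*} {G : SimpleGraph V}
    (hC3 : ¬ HasSubgraphCopy (cycleGraph 3) G) {H : SimpleGraph W} (f : H →g G)
    (hH : ∀ a b, a ≠ b → H.Adj a b ∨ ∃ c, H.Adj a c ∧ H.Adj c b) (a b : W)
    (hab : G.Adj (f a) (f b)) : H.Adj a b := by
  have hne : a ≠ b := fun h => hab.ne (congrArg f h)
  refine (hH a b hne).resolve_right ?_
  rintro ⟨c, hac, hcb⟩
  exact not_adj_of_common_neighbor hC3 (f.map_adj hac) (f.map_adj hcb) hab.symm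

theorem hasSubgraphCopy_pathGraph_of_adj_succ {V : Type*} {G : SimpleGraph V} {n : ℕ}
    (p : Fin (n + 1) → V) (hp : Function.Injective p)
    (hadj : ∀ i : Fin n, G.Adj (p i.castSucc) (p i.succ)) :
    HasSubgraphCopy (pathGraph (n + 1)) G := by
  have key (a b : Fin (n + 1)) (h : a.val + 1 = b.val) : G.Adj (p a) (p b) := by
    have := hadj ⟨a, by omega⟩
    rwa [show b = Fin.succ ⟨a, by omega⟩ from Fin.ext h.symm]
  refine ⟨⟨p, ?_⟩, hp⟩
  intro a b hab
  rcases pathGraph_adj.1 hab with h | h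
  · exact key a b h
  · exact (key b a h).symm

theorem hasSubgraphCopy_pathGraph_of_cycleGraph {V : Type*} {G : SimpleGraph V} {m n : ℕ}
    (hmn : m + 1 ≤ n) (f : cycleGraph n →g G) (hf : Function.Injective f) :
    HasSubgraphCopy (pathGraph (m + 1)) G := by
  refine hasSubgraphCopy_pathGraph_of_adj_succ (fun i => f (Fin.castLE hmn i))
    (hf.comp (Fin.castLE_injective hmn)) fun i => f.map_adj (pathGraph_le_cycleGraph ?_)
  exact pathGraph_adj.2 (Or.inl rfl)

/-- An edge leaving a cycle of length `n`, followed once around the cycle, is a path on `n + 1`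
vertices. -/
theorem hasSubgraphCopy_pathGraph_of_adj_cycle {V : Type*} {G : SimpleGraph V} {n : ℕ}
    (f : cycleGraph (n + 2) →g G) (hf : Function.Injective f) {w : V} (hw : w ∉ Set.range f)
    (i : Fin (n + 2)) (hi : G.Adj w (f i)) : HasSubgraphCopy (pathGraph (n + 3)) G := by
  refine hasSubgraphCopy_pathGraph_of_adj_succ (Fin.cons w fun j => f (i + j)) ?_ ?_
  · refine Fin.cons_injective_iff.2 ⟨?_, hf.comp (add_right_injective i)⟩
    rintro ⟨j, hj⟩
    exact hw ⟨i + j, hj⟩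
  · intro j
    induction j using Fin.cases with
    | zero => simpa using hi
    | succ j =>
      rw [← Fin.succ_castSucc, Fin.cons_succ, Fin.cons_succ]
      refine f.map_adj (cycleGraph_adj.2 (Or.inr ?_))
      rw [add_sub_add_left_eq_sub, ← Fin.coeSucc_eq_succ, add_sub_cancel_left]

theorem SimpleGraph.Connected.exists_adj_of_ne_univ {V : Type*} {G : SimpleGraph V}
    (hG : G.Connected) {S : Set V} (hne : S.Nonempty) (hS : S ≠ Set.univ) :
    ∃ u ∈ S, ∃ w ∉ S, G.Adj u w := by
  obtain ⟨u, hu⟩ := hne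
  obtain ⟨w, hw⟩ := (Set.ne_univ_iff_exists_notMem S).1 hS
  obtain ⟨p⟩ := hG.preconnected u w
  obtain ⟨d, -, hd, hd'⟩ := p.exists_boundary_dart S hu hw
  exact ⟨d.fst, hd, d.snd, hd', d.adj⟩

/-- If a connected graph `G` is not isomorphic to `C₅` and contains neither `C₃` nor `P₆`
as a subgraph, then every cycle of `G` is a chordless cycle of length four. -/
theorem forbidden_implies_cycles_chordless_four {V : Type*} [Fintype V] (G : SimpleGraph V)
    (hconn : G.Connected)
    (hC5 : ¬ Nonempty (G ≃g cycleGraph 5))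
    (hC3 : ¬ HasSubgraphCopy (cycleGraph 3) G)
    (hP6 : ¬ HasSubgraphCopy (pathGraph 6) G) :
    ∀ (n : ℕ), 3 ≤ n → ∀ f : cycleGraph n →g G, Function.Injective f →
      n = 4 ∧ ∀ a b : Fin n, G.Adj (f a) (f b) → (cycleGraph n).Adj a b := by
  intro n hn f hf
  have hn6 : n < 6 := by
    by_contra! h
    exact hP6 (hasSubgraphCopy_pathGraph_of_cycleGraph h f hf)
  interval_cases n
  · exact absurd ⟨f, hf⟩ hC3
  · exact ⟨rfl, chordless_of_common_neighbor hC3 f (by decide)⟩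
  · have hchord := chordless_of_common_neighbor hC3 f (by decide)
    by_cases hsurj : Function.Surjective f
    · refine absurd ⟨RelIso.symm ⟨Equiv.ofBijective f ⟨hf, hsurj⟩, ?_⟩⟩ hC5
      exact ⟨hchord _ _, f.map_adj⟩
    · obtain ⟨_, ⟨i, rfl⟩, w, hw, hadj⟩ := hconn.exists_adj_of_ne_univ
        (Set.range_nonempty f) (mt Set.range_eq_univ.1 hsurj)
      exact absurd (hasSubgraphCopy_pathGraph_of_adj_cycle f hf hw i hadj.symm) hP6
end

section
/- A non-trivial connected finite simple graph G is γβ-perfect if and only if G is a tree of diameter at most four or G is isomorphic to a connected subgraph of K_{2,n} for some n. -/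
open SimpleGraph

lemma SimpleGraph.Connected.forall_of_adj_s14 {V : Type*} {G : SimpleGraph V} (hG : G.Connected)
    {P : V → Prop} {u : V} (hu : P u) (hP : ∀ x y, P x → G.Adj x y → P y) (v : V) : P v := by
  obtain ⟨p⟩ := hG.preconnected u v
  induction p with
  | nil => exact hu
  | cons h _ ih => exact ih (hP _ _ hu h)

/-- In a nontrivial connected finite graph every vertex cover is dominating, so `γ = β` as soon
as every dominating set can be matched by a vertex cover of at most the same size. -/
lemma domNum_eq_covNum_of_forall_exists {V : Type*} [Nontrivial V] {G : SimpleGraph V}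
    (hconn : G.Connected)
    (h : ∀ D : Set V, IsDomSet G D → ∃ C : Set V, IsVtxCover G C ∧ C.ncard ≤ D.ncard) :
    domNum G = covNum G := by
  unfold domNum covNum
  apply le_antisymm
  · refine le_csInf ⟨_, Set.univ, fun _ _ _ => Or.inl trivial, rfl⟩ ?_
    rintro _ ⟨C, hC, rfl⟩
    refine Nat.sInf_le ⟨C, fun v hv => ?_, rfl⟩
    obtain ⟨u, hu⟩ := hconn.preconnected.exists_adj_of_nontrivial v
    exact ⟨u, (hC hu).resolve_left hv, hu.symm⟩
  · refine le_csInf ⟨_, Set.univ, fun v hv => absurd trivial hv, rfl⟩ ?_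
    rintro _ ⟨D, hD, rfl⟩
    obtain ⟨C, hC, hCD⟩ := h D hD
    exact le_trans (Nat.sInf_le ⟨C, hC, rfl⟩) hCD

lemma exists_isVtxCover_of_hom_completeBipartiteGraph {V : Type*} [Finite V] [Nonempty V]
    {G : SimpleGraph V} {n : ℕ} (f : G →g completeBipartiteGraph (Fin 2) (Fin n))
    (hf : Function.Injective f) {D : Set V} (hD : IsDomSet G D) :
    ∃ C : Set V, IsVtxCover G C ∧ C.ncard ≤ D.ncard := by
  by_cases hcard : 2 ≤ D.ncard
  · refine ⟨f ⁻¹' Set.range Sum.inl, fun u v huv => ?_, ?_⟩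
    · have := f.map_adj huv
      rw [completeBipartiteGraph_adj] at this
      rcases this with ⟨h, -⟩ | ⟨-, h⟩
      · exact Or.inl (by obtain ⟨y, hy⟩ := Sum.isLeft_iff.1 h; exact ⟨y, hy.symm⟩)
      · exact Or.inr (by obtain ⟨y, hy⟩ := Sum.isLeft_iff.1 h; exact ⟨y, hy.symm⟩)
    · refine le_trans ?_ hcard
      calc (f ⁻¹' Set.range Sum.inl).ncard
          ≤ (Set.range (Sum.inl : Fin 2 → Fin 2 ⊕ Fin n)).ncard :=
            Set.ncard_le_ncard_of_injOn f (fun a ha => ha) hf.injOn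
        _ = 2 := by
          rw [← Set.image_univ, Set.ncard_image_of_injective _ Sum.inl_injective]
          simp
  · refine ⟨D, fun u v huv => ?_, le_rfl⟩
    by_contra! hne
    obtain ⟨d, hd, hdu⟩ := hD u hne.1
    obtain ⟨e, he, hev⟩ := hD v hne.2
    obtain rfl : d = e := (Set.ncard_le_one (Set.toFinite D)).1 (by omega) d hd e he
    have h1 := f.map_adj huv
    have h2 := f.map_adj hdu
    have h3 := f.map_adj hev
    rw [completeBipartiteGraph_adj] at h1 h2 h3
    cases hu : f u <;> cases hv : f v <;> cases hd : f d <;> simp_all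

lemma exists_isVtxCover_of_isAcyclic {V : Type*} [Finite V] [Nontrivial V]
    {G : SimpleGraph V} (hconn : G.Connected) (hG : G.IsAcyclic)
    (hP : ∀ (u v : V) (p : G.Walk u v), p.IsPath → p.length ≠ 5)
    {D : Set V} (hD : IsDomSet G D) :
    ∃ C : Set V, IsVtxCover G C ∧ C.ncard ≤ D.ncard := by
  classical
  let leafAt : V → V → Prop := fun s l => G.Adj l s ∧ ∀ w, G.Adj l w → w = s
  by_cases hiso : ∃ u v, leafAt u v ∧ leafAt v u
  · obtain ⟨u, v, huv, hvu⟩ := hiso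
    have hall : ∀ w, w = u ∨ w = v := by
      refine hconn.forall_of_adj_s14 (Or.inl rfl) ?_
      rintro x y (rfl | rfl) hxy
      · exact Or.inr (hvu.2 _ hxy)
      · exact Or.inl (huv.2 _ hxy)
    have hne : D.Nonempty := by
      by_contra hDe
      obtain ⟨d, hd, -⟩ := hD u (fun h => hDe ⟨u, h⟩)
      exact hDe ⟨d, hd⟩
    refine ⟨{u}, fun a b hab => ?_, ?_⟩
    · have := hab.ne
      rcases hall a with rfl | rfl <;> rcases hall b with rfl | rfl <;> simp_all
    · rw [Set.ncard_singleton]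
      exact (Set.ncard_pos (Set.toFinite D)).2 hne
  · refine ⟨{s | ∃ l, leafAt s l}, fun u v huv => ?_, ?_⟩
    · by_contra! hne
      have key : ∀ s t, G.Adj s t → (¬ ∃ l, leafAt t l) → (¬ ∃ l, leafAt s l) →
          ∃ x y, G.Adj s x ∧ G.Adj x y ∧ x ≠ t ∧ y ≠ s := by
        intro s t hst ht hs
        have h1 : ∃ x, G.Adj s x ∧ x ≠ t := by
          by_contra! h
          exact ht ⟨s, hst, h⟩
        obtain ⟨x, hx, hxt⟩ := h1
        have h2 : ∃ y, G.Adj x y ∧ y ≠ s := by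
          by_contra! h
          exact hs ⟨x, hx.symm, h⟩
        obtain ⟨y, hy, hys⟩ := h2
        exact ⟨x, y, hx, hy, hxt, hys⟩
      obtain ⟨x, y, hx, hy, hxt, hys⟩ := key u v huv hne.2 hne.1
      obtain ⟨x', y', hx', hy', hxt', hys'⟩ := key v u huv.symm hne.1 hne.2
      refine hP _ _ (.cons hy.symm (.cons hx.symm (.cons huv (.cons hx' (.cons hy' .nil))))) ?_ rfl
      rw [hG.isPath_iff_isChain]
      simp
      grind
    · have hl : ∀ s, ∃ t, (∃ l, leafAt s l) → t ∈ D ∧ (t = s ∨ (s ∉ D ∧ leafAt s t)) := by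
        intro s
        by_cases hs : s ∈ D
        · exact ⟨s, fun _ => ⟨hs, Or.inl rfl⟩⟩
        · by_cases h : ∃ l, leafAt s l
          · obtain ⟨l, hl⟩ := h
            refine ⟨l, fun _ => ⟨?_, Or.inr ⟨hs, hl⟩⟩⟩
            by_contra hlD
            obtain ⟨w, hw, hwl⟩ := hD l hlD
            exact hs (hl.2 w hwl.symm ▸ hw)
          · exact ⟨s, fun h' => absurd h' h⟩
      choose f hf using hl
      refine Set.ncard_le_ncard_of_injOn f (fun s hs => (hf s hs).1) ?_
      intro s hs t ht hst
      obtain ⟨-, h1⟩ := hf s hs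
      obtain ⟨-, h2⟩ := hf t ht
      rw [hst] at h1
      have noboth : ∀ a b, leafAt a b → ¬ ∃ l, leafAt b l := by
        rintro a b hab ⟨l, hl⟩
        have := hab.2 l hl.1.symm
        subst this
        exact hiso ⟨_, _, hab, hl⟩
      rcases h1 with h1 | ⟨-, h1⟩ <;> rcases h2 with h2 | ⟨-, h2⟩
      · exact h1.symm.trans h2
      · rw [h1] at h2
        exact absurd hs (noboth _ _ h2)
      · rw [h2] at h1
        exact absurd ht (noboth _ _ h1)
      · exact (h2.2 _ h1.1)

lemma SimpleGraph.IsTree.length_le_diam {V : Type*} [Finite V] {G : SimpleGraph V}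
    (hG : G.IsTree) {u v : V} {p : G.Walk u v} (hp : p.IsPath) : p.length ≤ G.diam := by
  obtain ⟨q, hq, hql⟩ := hG.connected.exists_path_of_dist u v
  have := hG.connected.nonempty
  have hpq : (⟨p, hp⟩ : G.Path u v) = ⟨q, hq⟩ :=
    (hG.isAcyclic.subsingleton_path u v).elim _ _
  obtain rfl : p = q := congrArg Subtype.val hpq
  rw [hql]
  exact SimpleGraph.dist_le_diam (connected_iff_ediam_ne_top.1 hG.connected)

namespace GammaBetaPerfect

variable {V : Type*} [Fintype V] {G : SimpleGraph V}

lemma exists_cover_support (hG : GammaBetaPerfect G) {u v : V} (p : G.Walk u v)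
    (hp : p.length ≠ 0) (D : Set V) (hDp : ∀ x ∈ D, x ∈ p.support)
    (hD : ∀ x ∈ p.support, x ∉ D → ∃ y ∈ D, G.Adj y x) :
    ∃ C : Set V, C.ncard ≤ D.ncard ∧
      ∀ x ∈ p.support, ∀ y ∈ p.support, G.Adj x y → x ∈ C ∨ y ∈ C := by
  classical
  let S : Set V := {x | x ∈ p.support}
  have hnil : ¬ p.Nil := fun h => hp (Walk.length_eq_zero_iff.2 h)
  have h2 : 2 ≤ S.ncard := by
    refine (Set.one_lt_ncard (Set.toFinite S)).2
      ⟨u, p.start_mem_support, p.snd, p.getVert_mem_support 1, ?_⟩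
    exact (p.adj_snd hnil).ne
  have heq := hG.2.2 S p.connected_induce_support h2
  have hdom : domNum (G.induce S) ≤ D.ncard := by
    refine Nat.sInf_le ⟨Subtype.val ⁻¹' D, ?_, ?_⟩
    · rintro ⟨x, hx⟩ hxD
      obtain ⟨y, hy, hyx⟩ := hD x hx hxD
      exact ⟨⟨y, hDp y hy⟩, hy, hyx⟩
    · exact Set.ncard_preimage_of_injective_subset_range Subtype.val_injective
        (by rw [Subtype.range_coe]; exact hDp)
  obtain ⟨C, hC, hCn⟩ : covNum (G.induce S) ∈
      {n | ∃ C : Set S, IsVtxCover (G.induce S) C ∧ C.ncard = n} :=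
    Nat.sInf_mem ⟨_, Set.univ, fun _ _ _ => Or.inl trivial, rfl⟩
  refine ⟨Subtype.val '' C, ?_, fun x hx y hy hxy => ?_⟩
  · rw [Set.ncard_image_of_injective _ Subtype.val_injective, hCn, ← heq]
    exact hdom
  · rcases hC (u := ⟨x, hx⟩) (v := ⟨y, hy⟩) hxy with h | h
    · exact Or.inl ⟨_, h, rfl⟩
    · exact Or.inr ⟨_, h, rfl⟩

lemma not_triangle (hG : GammaBetaPerfect G) {a b c : V} (hab : G.Adj a b) (hbc : G.Adj b c)
    (hca : G.Adj c a) : False := by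
  obtain ⟨C, hC, hcov⟩ := hG.exists_cover_support (.cons hab (.cons hbc .nil)) (by simp) {a}
    (by simp) (by
      have := hca.symm
      simp_all)
  rw [Set.ncard_singleton, Set.ncard_le_one] at hC
  have h1 := hcov a (by simp) b (by simp) hab
  have h2 := hcov b (by simp) c (by simp) hbc
  have h3 := hcov c (by simp) a (by simp) hca
  grind [G.ne_of_adj hab, G.ne_of_adj hbc, G.ne_of_adj hca]

lemma not_three_mem_of_ncard_le_pair {C : Set V} {x y : V}
    (hC : C.ncard ≤ ({x, y} : Set V).ncard) {a b c : V} (ha : a ∈ C) (hb : b ∈ C) (hc : c ∈ C)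
    (hab : a ≠ b) (hac : a ≠ c) (hbc : b ≠ c) : False := by
  have h1 : 2 < C.ncard := (Set.two_lt_ncard (Set.toFinite C)).2
    ⟨a, ha, b, hb, c, hc, hab, hac, hbc⟩
  have h2 := Set.ncard_insert_le x {y}
  rw [Set.ncard_singleton] at h2
  omega

lemma not_cycle_five (hG : GammaBetaPerfect G) {a b c d e : V} (hab : G.Adj a b)
    (hbc : G.Adj b c) (hcd : G.Adj c d) (hde : G.Adj d e) (hea : G.Adj e a)
    (hn : [a, b, c, d, e].Nodup) : False := by
  obtain ⟨C, hC, hcov⟩ := hG.exists_cover_support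
    (.cons hab (.cons hbc (.cons hcd (.cons hde .nil)))) (by simp) {a, c}
    (by simp) (by
      have := hea.symm
      simp; grind [G.adj_comm])
  have h1 := hcov a (by simp) b (by simp) hab
  have h2 := hcov b (by simp) c (by simp) hbc
  have h3 := hcov c (by simp) d (by simp) hcd
  have h4 := hcov d (by simp) e (by simp) hde
  have h5 := hcov e (by simp) a (by simp) hea
  have h6 := @not_three_mem_of_ncard_le_pair V _ C a c hC
  simp at hn
  grind

lemma length_ne_five (hG : GammaBetaPerfect G) {u v : V} {p : G.Walk u v} (hp : p.IsPath) :
    p.length ≠ 5 := by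
  intro hl
  have hD := hG.exists_cover_support p (by omega) {p.getVert 1, p.getVert 4} (by simp) ?_
  · obtain ⟨C, hC, hcov⟩ := hD
    have hm := fun i => p.getVert_mem_support i
    have h1 := hcov _ (hm 0) _ (hm 1) (p.adj_getVert_succ (by omega))
    have h2 := hcov _ (hm 2) _ (hm 3) (p.adj_getVert_succ (by omega))
    have h3 := hcov _ (hm 4) _ (hm 5) (p.adj_getVert_succ (by omega))
    have hinj : ∀ i j, i ≤ 5 → j ≤ 5 → i ≠ j → p.getVert i ≠ p.getVert j :=
      fun i j hi hj hij h => hij (hp.getVert_injOn (by simp; omega) (by simp; omega) h)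
    have := @not_three_mem_of_ncard_le_pair V _ C _ _ hC
    rcases h1 with h1 | h1 <;> rcases h2 with h2 | h2 <;> rcases h3 with h3 | h3 <;>
      exact this h1 h2 h3 (hinj _ _ (by omega) (by omega) (by omega))
        (hinj _ _ (by omega) (by omega) (by omega)) (hinj _ _ (by omega) (by omega) (by omega))
  · intro x hx hxD
    rw [Walk.mem_support_iff_exists_getVert] at hx
    obtain ⟨i, rfl, hi⟩ := hx
    have hadj := fun j (hj : j < 5) => p.adj_getVert_succ (i := j) (by omega)
    rw [hl] at hi
    interval_cases i
    · exact ⟨_, Or.inl rfl, (hadj 0 (by omega)).symm⟩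
    · exact absurd (Or.inl rfl) hxD
    · exact ⟨_, Or.inl rfl, hadj 1 (by omega)⟩
    · exact ⟨_, Or.inr rfl, (hadj 3 (by omega)).symm⟩
    · exact absurd (Or.inr rfl) hxD
    · exact ⟨_, Or.inr rfl, hadj 4 (by omega)⟩

lemma not_path_six (hG : GammaBetaPerfect G) {a b c d e f : V} (hab : G.Adj a b)
    (hbc : G.Adj b c) (hcd : G.Adj c d) (hde : G.Adj d e) (hef : G.Adj e f)
    (hn : [a, b, c, d, e, f].Nodup) : False :=
  hG.length_ne_five (p := .cons hab (.cons hbc (.cons hcd (.cons hde (.cons hef .nil)))))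
    (by rw [Walk.isPath_def]; simpa using hn) rfl

lemma length_le_four (hG : GammaBetaPerfect G) {u v : V} {p : G.Walk u v} (hp : p.IsPath) :
    p.length ≤ 4 := by
  by_contra! h
  exact hG.length_ne_five (hp.take 5) (by simp; omega)

lemma diam_le_four (hG : GammaBetaPerfect G) : G.diam ≤ 4 := by
  have := hG.1.nonempty
  obtain ⟨u, v, huv⟩ := G.exists_dist_eq_diam
  obtain ⟨p, hp, hpl⟩ := hG.1.exists_path_of_dist u v
  rw [← huv, ← hpl]
  exact hG.length_le_four hp

lemma exists_cycle_four (hG : GammaBetaPerfect G) (hcyc : ¬ G.IsAcyclic) :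
    ∃ a b c d, G.Adj a b ∧ G.Adj b c ∧ G.Adj c d ∧ G.Adj d a ∧ [a, b, c, d].Nodup := by
  simp only [IsAcyclic, not_forall, not_not] at hcyc
  obtain ⟨v, c, hc⟩ := hcyc
  have h3 := hc.three_le_length
  have hadj := fun j (hj : j < c.length) => c.adj_getVert_succ hj
  have hinj : ∀ i j, i < c.length → j < c.length → i ≠ j → c.getVert i ≠ c.getVert j :=
    fun i j hi hj hij h => hij (hc.getVert_injOn' (by simp; omega) (by simp; omega) h)
  have hend : c.getVert c.length = c.getVert 0 := by simp
  obtain hl | hl | hl | hl : c.length = 3 ∨ c.length = 4 ∨ c.length = 5 ∨ 6 ≤ c.length := by omega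
  · rw [hl] at hadj hend
    exact (hG.not_triangle (hadj 0 (by omega)) (hadj 1 (by omega))
      (hend ▸ hadj 2 (by omega))).elim
  · rw [hl] at hadj hend hinj
    refine ⟨_, _, _, _, hadj 0 (by omega), hadj 1 (by omega), hadj 2 (by omega),
      hend ▸ hadj 3 (by omega), ?_⟩
    simp only [List.nodup_cons, List.mem_cons, List.not_mem_nil, or_false, not_or]
    grind
  · rw [hl] at hadj hend hinj
    refine (hG.not_cycle_five (hadj 0 (by omega)) (hadj 1 (by omega)) (hadj 2 (by omega))
      (hadj 3 (by omega)) (hend ▸ hadj 4 (by omega)) ?_).elim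
    simp only [List.nodup_cons, List.mem_cons, List.not_mem_nil, or_false, not_or]
    grind
  · refine (hG.not_path_six (hadj 0 (by omega)) (hadj 1 (by omega)) (hadj 2 (by omega))
      (hadj 3 (by omega)) (hadj 4 (by omega)) ?_).elim
    simp only [List.nodup_cons, List.mem_cons, List.not_mem_nil, or_false, not_or]
    grind

/-- If the vertices `a`, `c` of a 4-cycle `a b c d` have no further neighbors, then every edge
has exactly one end in `{b, d}`. -/
lemma adj_iff_of_cycle_four (hG : GammaBetaPerfect G) {a b c d : V} (hab : G.Adj a b)
    (hbc : G.Adj b c) (hcd : G.Adj c d) (hda : G.Adj d a) (hn : [a, b, c, d].Nodup)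
    (ha : ∀ x, G.Adj a x → x = b ∨ x = d) (hc : ∀ x, G.Adj c x → x = b ∨ x = d)
    {u v : V} (huv : G.Adj u v) : (u = b ∨ u = d) ↔ ¬ (v = b ∨ v = d) := by
  have hstep : ∀ x y, (G.Adj b x ∨ G.Adj d x) → G.Adj x y → y = b ∨ y = d := by
    intro x y hx hxy
    by_contra! hy
    have hxa : x ≠ a := by rintro rfl; exact absurd (ha y hxy) (by tauto)
    have hxc : x ≠ c := by rintro rfl; exact absurd (hc y hxy) (by tauto)
    have hya : y ≠ a := by
      rintro rfl
      rcases ha x hxy.symm with rfl | rfl <;> rcases hx with hx | hx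
      · exact hx.ne rfl
      · exact hG.not_triangle hx hab.symm hda.symm
      · exact hG.not_triangle hx hda hab
      · exact hx.ne rfl
    have hyc : y ≠ c := by
      rintro rfl
      rcases hc x hxy.symm with rfl | rfl <;> rcases hx with hx | hx
      · exact hx.ne rfl
      · exact hG.not_triangle hx hbc hcd
      · exact hG.not_triangle hx hcd.symm hbc.symm
      · exact hx.ne rfl
    simp at hn
    have hxy' := hxy.ne
    rcases hx with hx | hx
    · have hxb := hx.ne
      by_cases hxd : x = d
      · subst hxd
        exact hG.not_triangle hx hda hab
      · exact hG.not_path_six hxy.symm hx.symm hab.symm hda.symm hcd.symm (by simp; grind)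
    · have hxd := hx.ne
      by_cases hxb : x = b
      · subst hxb
        exact hG.not_triangle hx hab.symm hda.symm
      · exact hG.not_path_six hxy.symm hx.symm hda hab hbc (by simp; grind)
  have hbd : ¬ G.Adj b d := fun h => hG.not_triangle h hda hab
  have hdom : ∀ x, (x = b ∨ x = d) ∨ (G.Adj b x ∨ G.Adj d x) := by
    refine hG.1.forall_of_adj_s14 (Or.inl (Or.inl rfl)) ?_
    rintro x y ((rfl | rfl) | hx) hxy
    · exact Or.inr (Or.inl hxy)
    · exact Or.inr (Or.inr hxy)
    · exact Or.inl (hstep x y hx hxy)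
  constructor
  · rintro (rfl | rfl) (rfl | rfl)
    · exact huv.ne rfl
    · exact hbd huv
    · exact hbd huv.symm
    · exact huv.ne rfl
  · intro hv
    by_contra hu
    exact hv (hstep u v ((hdom u).resolve_left hu) huv)

lemma exists_hom_of_cycle_four (hG : GammaBetaPerfect G) {a b c d : V} (hab : G.Adj a b)
    (hbc : G.Adj b c) (hcd : G.Adj c d) (hda : G.Adj d a) (hn : [a, b, c, d].Nodup)
    (ha : ∀ x, G.Adj a x → x = b ∨ x = d) (hc : ∀ x, G.Adj c x → x = b ∨ x = d) :
    ∃ n : ℕ, ∃ f : G →g completeBipartiteGraph (Fin 2) (Fin n), Function.Injective f := by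
  classical
  let g : V → Fin 2 ⊕ Fin (Fintype.card V) := fun x =>
    if x = b then Sum.inl 0 else if x = d then Sum.inl 1 else Sum.inr (Fintype.equivFin V x)
  refine ⟨Fintype.card V, ⟨g, fun {u v} huv => ?_⟩, fun u v huv => ?_⟩
  · have := hG.adj_iff_of_cycle_four hab hbc hcd hda hn ha hc huv
    rw [completeBipartiteGraph_adj]
    simp only [g]
    split_ifs <;> simp_all
  · change g u = g v at huv
    simp only [g] at huv
    split_ifs at huv <;> simp_all

lemma exists_hom_of_not_isAcyclic (hG : GammaBetaPerfect G) (hcyc : ¬ G.IsAcyclic) :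
    ∃ n : ℕ, ∃ f : G →g completeBipartiteGraph (Fin 2) (Fin n), Function.Injective f := by
  obtain ⟨a, b, c, d, hab, hbc, hcd, hda, hn⟩ := hG.exists_cycle_four hcyc
  -- two outside vertices attached to adjacent vertices of the cycle yield a six-vertex path
  have key : ∀ {a b c d x y : V}, G.Adj a b → G.Adj b c → G.Adj c d → G.Adj d a →
      [a, b, c, d].Nodup → G.Adj a x → x ≠ b → x ≠ d → G.Adj b y → y ≠ a → y ≠ c → False := by
    intro a b c d x y hab hbc hcd hda hn hx hxb hxd hy hya hyc
    have hxc : x ≠ c := by rintro rfl; exact hG.not_triangle hx hcd hda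
    have hyd : y ≠ d := by rintro rfl; exact hG.not_triangle hy hda hab
    have hxy : x ≠ y := by rintro rfl; exact hG.not_triangle hx hy.symm hab.symm
    have := hx.ne
    have := hy.ne
    refine hG.not_path_six hx.symm hda.symm hcd.symm hbc.symm hy ?_
    simp at hn ⊢
    grind
  by_cases h : (∀ x, G.Adj a x → x = b ∨ x = d) ∧ (∀ x, G.Adj c x → x = b ∨ x = d)
  · exact hG.exists_hom_of_cycle_four hab hbc hcd hda hn h.1 h.2
  · simp at hn
    refine hG.exists_hom_of_cycle_four hbc hcd hda hab (by simp; grind) ?_ ?_ <;>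
    · intro x hx
      by_contra! hx'
      apply h
      constructor <;>
      · intro y hy
        by_contra! hy'
        first
        | exact key hab hbc hcd hda (by simp; grind) hy hy'.1 hy'.2 hx hx'.2 hx'.1
        | exact key hda.symm hcd.symm hbc.symm hab.symm (by simp; grind)
            hy hy'.2 hy'.1 hx hx'.2 hx'.1
        | exact key hcd hda hab hbc (by simp; grind) hy hy'.2 hy'.1 hx hx'.1 hx'.2
        | exact key hbc.symm hab.symm hda.symm hcd.symm (by simp; grind)
            hy hy'.1 hy'.2 hx hx'.1 hx'.2

end GammaBetaPerfect

/-- A non-trivial connected graph `G` is γβ-perfect if and only if `G` is a tree of diameter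
at most four or `G` is isomorphic to a connected subgraph of `K_{2,n}` for some `n`. -/
theorem gammaBetaPerfect_iff_structure {V : Type*} [Fintype V] (G : SimpleGraph V)
    (hconn : G.Connected) (hnontrivial : 2 ≤ Fintype.card V) :
    GammaBetaPerfect G ↔
      (G.IsTree ∧ G.diam ≤ 4) ∨
        ∃ n : ℕ, ∃ f : G →g completeBipartiteGraph (Fin 2) (Fin n), Function.Injective f := by
  constructor
  · intro hG
    by_cases hcyc : G.IsAcyclic
    · exact Or.inl ⟨⟨hconn, hcyc⟩, hG.diam_le_four⟩
    · exact Or.inr (hG.exists_hom_of_not_isAcyclic hcyc)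
  · intro h
    refine ⟨hconn, hnontrivial, fun S hS hS2 => ?_⟩
    have : Nontrivial S := by
      rw [Set.nontrivial_coe_sort]
      exact Set.one_lt_ncard_iff_nontrivial.1 hS2
    refine domNum_eq_covNum_of_forall_exists hS fun D hD => ?_
    let ι : G.induce S ↪g G := Embedding.induce S
    rcases h with ⟨htree, hdiam⟩ | ⟨n, f, hf⟩
    · refine exists_isVtxCover_of_isAcyclic hS (htree.isAcyclic.induce S) ?_ hD
      intro u v p hp hl
      have := htree.length_le_diam (Walk.IsPath.map (f := ι.toHom) ι.injective hp)
      rw [Walk.length_map] at this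
      omega
    · exact exists_isVtxCover_of_hom_completeBipartiteGraph (f.comp ι.toHom)
        (hf.comp ι.injective) hD
end
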